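/- In the free π-augmented pregroup on the one-element discrete partially ordered set P = {p}, the two-term word [π(p)]^(0), p^(1) (i.e. π(p)·pʳ) does NOT rewrite to the empty word 1; that is, [π(p)]·pʳ ⇒ 1 fails. -/

import Mathlib

universe u

/-! The free π-augmented pregroup on a partially ordered set `P`.
A word is a list of terms, where a term is either `p^(n)` for an atom `p ∈ P` and `n ∈ ℤ`,
or `[π(w)]^(n)` for a word `w` and `n ∈ ℤ`. -/

/-- Terms of the free π-augmented pregroup: `atom p n` is `p^(n)`,
`pi w n` is `[π(w)]^(n)` where the word `w` is a list of terms. -/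
inductive Tm (P : Type*) : Type _
  | atom : P → ℤ → Tm P
  | pi : List (Tm P) → ℤ → Tm P

/-- Shift the superscript of a term by `k` (iterated adjoint on a single term). -/
def Tm.shift {P : Type*} (k : ℤ) : Tm P → Tm P
  | .atom p n => .atom p (n + k)
  | .pi w n => .pi w (n + k)

/-- The `k`-th iterated adjoint `w^(k)` of a word `w`: shift every superscript by `k`,
reversing the order of the terms when `k` is odd. -/
def wshift {P : Type*} (k : ℤ) (w : List (Tm P)) : List (Tm P) :=
  if k % 2 = 0 then w.map (Tm.shift k) else (w.map (Tm.shift k)).reverse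

/-- The special rules: (IND), (π-IND), (m-IND) and (PRE). -/
inductive SpecStep {P : Type*} [PartialOrder P] : List (Tm P) → List (Tm P) → Prop
  | ind_even (X Y : List (Tm P)) (p q : P) (n : ℤ) (h : p ≤ q) :
      SpecStep (X ++ [Tm.atom p (2 * n)] ++ Y) (X ++ [Tm.atom q (2 * n)] ++ Y)
  | ind_odd (X Y : List (Tm P)) (p q : P) (n : ℤ) (h : p ≤ q) :
      SpecStep (X ++ [Tm.atom q (2 * n + 1)] ++ Y) (X ++ [Tm.atom p (2 * n + 1)] ++ Y)
  | piind_even (X Z W W' : List (Tm P)) (n : ℤ) (h : SpecStep W W') :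
      SpecStep (X ++ [Tm.pi W (2 * n)] ++ Z) (X ++ [Tm.pi W' (2 * n)] ++ Z)
  | piind_odd (X Z W W' : List (Tm P)) (n : ℤ) (h : SpecStep W W') :
      SpecStep (X ++ [Tm.pi W' (2 * n + 1)] ++ Z) (X ++ [Tm.pi W (2 * n + 1)] ++ Z)
  | mind_even (X Z W W' : List (Tm P)) (n : ℤ) (h : SpecStep W W') :
      SpecStep (X ++ wshift (2 * n) W ++ Z) (X ++ [Tm.pi W' (2 * n)] ++ Z)
  | mind_odd (X Z W W' : List (Tm P)) (n : ℤ) (h : SpecStep W W') :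
      SpecStep (X ++ [Tm.pi W' (2 * n + 1)] ++ Z) (X ++ wshift (2 * n + 1) W ++ Z)
  | pre (X Z W W' : List (Tm P)) :
      SpecStep (X ++ [Tm.pi W 0, Tm.pi W' (-1)] ++ Z) (X ++ [Tm.pi W' 1, Tm.pi W 0] ++ Z)

mutual
/-- The contraction rules: (CON), (π-CON) and (IND-C). -/
inductive ConStep {P : Type u} [PartialOrder P] : List (Tm P) → List (Tm P) → Prop
  | con (X Y : List (Tm P)) (p : P) (n : ℤ) :
      ConStep (X ++ [Tm.atom p n, Tm.atom p (n + 1)] ++ Y) (X ++ Y)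
  | picon (X Y : List (Tm P)) (p : P) (n : ℤ) :
      ConStep (X ++ [Tm.pi [Tm.atom p 0] n, Tm.pi [Tm.atom p 0] (n + 1)] ++ Y) (X ++ Y)
  | indc_even (X Z W W' : List (Tm P)) (n : ℤ) (h : ConStep W W') :
      ConStep (X ++ [Tm.pi W (2 * n)] ++ Z) (X ++ [Tm.pi W' (2 * n)] ++ Z)
  | indc_odd (X Z W W' : List (Tm P)) (n : ℤ) (h : ExpStep W W') :
      ConStep (X ++ [Tm.pi W' (2 * n + 1)] ++ Z) (X ++ [Tm.pi W (2 * n + 1)] ++ Z)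

/-- The expansion rules: (EXP), (π-EXP) and (IND-E). -/
inductive ExpStep {P : Type u} [PartialOrder P] : List (Tm P) → List (Tm P) → Prop
  | exp (X Y : List (Tm P)) (p : P) (n : ℤ) :
      ExpStep (X ++ Y) (X ++ [Tm.atom p (n + 1), Tm.atom p n] ++ Y)
  | piexp (X Y : List (Tm P)) (p : P) (n : ℤ) :
      ExpStep (X ++ Y) (X ++ [Tm.pi [Tm.atom p 0] (n + 1), Tm.pi [Tm.atom p 0] n] ++ Y)
  | inde_even (X Z W W' : List (Tm P)) (n : ℤ) (h : ExpStep W W') :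
      ExpStep (X ++ [Tm.pi W (2 * n)] ++ Z) (X ++ [Tm.pi W' (2 * n)] ++ Z)
  | inde_odd (X Z W W' : List (Tm P)) (n : ℤ) (h : ConStep W W') :
      ExpStep (X ++ [Tm.pi W' (2 * n + 1)] ++ Z) (X ++ [Tm.pi W (2 * n + 1)] ++ Z)
end

/-- A rewriting step of the free π-augmented pregroup: a contraction rule,
an expansion rule, or a special rule. -/
def PStep {P : Type*} [PartialOrder P] (a b : List (Tm P)) : Prop :=
  ConStep a b ∨ ExpStep a b ∨ SpecStep a b

/-- A step which is not an expansion rule. -/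
def NoExpStep {P : Type*} [PartialOrder P] (a b : List (Tm P)) : Prop :=
  ConStep a b ∨ SpecStep a b

/-- A step which is not a contraction rule. -/
def NoConStep {P : Type*} [PartialOrder P] (a b : List (Tm P)) : Prop :=
  ExpStep a b ∨ SpecStep a b

/-- The one-element discrete partially ordered set `{p}`. -/
inductive Pt : Type
  | pt : Pt

/-- The discrete order on `Pt`: `x ≤ y` iff `x = y`. -/
instance : PartialOrder Pt where
  le x y := x = y
  le_refl _ := rfl
  le_trans _ _ _ h₁ h₂ := Eq.trans h₁ h₂
  le_antisymm _ _ h _ := h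

/-- The sign `(-1)^n` of the superscript `n`. -/
def altSign (n : ℤ) : ℤ := if n % 2 = 0 then 1 else -1

theorem altSign_even (n : ℤ) : altSign (2 * n) = 1 := by
  simp [altSign]

theorem altSign_odd (n : ℤ) : altSign (2 * n + 1) = -1 := by
  simp [altSign]

theorem altSign_add (m n : ℤ) : altSign (m + n) = altSign n * altSign m := by
  unfold altSign
  split_ifs <;> omega

theorem altSign_succ (n : ℤ) : altSign (n + 1) = -altSign n := by
  simp [altSign_add, show altSign 1 = -1 from rfl]

mutual
/-- An integer weight on terms: atoms weigh `0`, and each `π` adds `1` to the weight of the word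
below it; odd superscripts negate. -/
def Tm.value {P : Type*} : Tm P → ℤ
  | .atom _ _ => 0
  | .pi w n => altSign n * (wordValue w + 1)

/-- The weight of a word is the sum of the weights of its terms. -/
def wordValue {P : Type*} : List (Tm P) → ℤ
  | [] => 0
  | t :: w => Tm.value t + wordValue w
end

theorem wordValue_append {P : Type*} (X Y : List (Tm P)) :
    wordValue (X ++ Y) = wordValue X + wordValue Y := by
  induction X with
  | nil => simp [wordValue]
  | cons t X ih => simp [wordValue, ih, add_assoc]

theorem wordValue_reverse {P : Type*} (X : List (Tm P)) :
    wordValue X.reverse = wordValue X := by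
  induction X with
  | nil => rfl
  | cons t X ih => simp [wordValue, wordValue_append, ih, add_comm]

theorem Tm.value_shift {P : Type*} (k : ℤ) (t : Tm P) :
    (t.shift k).value = altSign k * t.value := by
  cases t <;> simp [Tm.shift, Tm.value, altSign_add, mul_assoc]

theorem wordValue_map_shift {P : Type*} (k : ℤ) (X : List (Tm P)) :
    wordValue (X.map (Tm.shift k)) = altSign k * wordValue X := by
  induction X with
  | nil => simp [wordValue]
  | cons t X ih => simp [wordValue, ih, Tm.value_shift, mul_add]

theorem wordValue_wshift {P : Type*} (k : ℤ) (X : List (Tm P)) :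
    wordValue (wshift k X) = altSign k * wordValue X := by
  unfold wshift
  split_ifs <;> simp [wordValue_reverse, wordValue_map_shift]

theorem SpecStep.wordValue_le {P : Type*} [PartialOrder P] {a b : List (Tm P)}
    (h : SpecStep a b) : wordValue a ≤ wordValue b := by
  induction h with
  | pre X Z W W' =>
    simp only [wordValue_append, wordValue, Tm.value, altSign]
    norm_num
    linarith
  | _ =>
    simp only [wordValue_append, wordValue, Tm.value, wordValue_wshift, altSign_even,
      altSign_odd]
    linarith

mutual
theorem ConStep.wordValue_le {P : Type*} [PartialOrder P] {a b : List (Tm P)} :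
    ConStep a b → wordValue a ≤ wordValue b
  | .con X Y p n => by simp [wordValue_append, wordValue, Tm.value]
  | .picon X Y p n => by simp [wordValue_append, wordValue, Tm.value, altSign_succ]
  | .indc_even X Z W W' n h => by
    have := ConStep.wordValue_le h
    simp only [wordValue_append, wordValue, Tm.value, altSign_even]
    linarith
  | .indc_odd X Z W W' n h => by
    have := ExpStep.wordValue_le h
    simp only [wordValue_append, wordValue, Tm.value, altSign_odd]
    linarith

theorem ExpStep.wordValue_le {P : Type*} [PartialOrder P] {a b : List (Tm P)} :
    ExpStep a b → wordValue a ≤ wordValue b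
  | .exp X Y p n => by simp [wordValue_append, wordValue, Tm.value]
  | .piexp X Y p n => by simp [wordValue_append, wordValue, Tm.value, altSign_succ]
  | .inde_even X Z W W' n h => by
    have := ExpStep.wordValue_le h
    simp only [wordValue_append, wordValue, Tm.value, altSign_even]
    linarith
  | .inde_odd X Z W W' n h => by
    have := ConStep.wordValue_le h
    simp only [wordValue_append, wordValue, Tm.value, altSign_odd]
    linarith
end

/-- Rewriting never decreases the weight of a word. -/
theorem wordValue_le_of_reflTransGen {P : Type*} [PartialOrder P] {a b : List (Tm P)}
    (h : Relation.ReflTransGen PStep a b) : wordValue a ≤ wordValue b := by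
  induction h with
  | refl => exact le_rfl
  | tail _ hs ih =>
    refine ih.trans ?_
    rcases hs with hs | hs | hs
    · exact hs.wordValue_le
    · exact hs.wordValue_le
    · exact hs.wordValue_le

/-- In the free π-augmented pregroup on the one-element discrete poset `{p}`, the word
`[π(p)]^(0), p^(1)` (i.e. `π(p)·pʳ`) does not rewrite to the empty word `1`. -/
theorem pi_p_pr_not_nullable :
    ¬ Relation.ReflTransGen PStep
        [Tm.pi [Tm.atom Pt.pt 0] 0, Tm.atom Pt.pt 1] ([] : List (Tm Pt)) := by
  intro h
  have h₁ := wordValue_le_of_reflTransGen h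
  norm_num [wordValue, Tm.value, altSign] at h₁
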